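/- arXiv:math/0102106 — 2 statements merged into one kernel-verified Lean document; each statement's English description precedes it below -/
import Mathlib

section
/- Finite analog of Jacobi's formula: for every nonnegative integer L, ∑_{l=0}^{L} a^{-l} · (1 + a^{2l+1})/(1+a) · q^{T_l} = ∑_{i,j,k ≥ 0} a^{i-j} (-1)^k q^{T_i + T_j + T_k} · C_q(L-k, i) · C_q(L-i, j) · C_q(L-j, k), as an identity of rational functions (Laurent polynomials) in a and q. -/
open Finset

/-- The field of rational functions in two indeterminates `a` and `q` over `ℚ`. -/
noncomputable abbrev K2 : Type := RatFunc (Polynomial ℚ)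

/-- The indeterminate `q`. -/
noncomputable def q : K2 := RatFunc.X

/-- The indeterminate `a`. -/
noncomputable def a : K2 := RatFunc.C Polynomial.X

/-- Triangular number `T m = m(m+1)/2`. -/
def T (m : ℤ) : ℤ := m * (m + 1) / 2

/-- The Gaussian binomial coefficient in base `q`: `C(N, n) = (q^{N-n+1};q)_n / (q;q)_n`
for `n ≥ 0`, and `0` when out of range (`n < 0`; for `0 ≤ N < n` the product contains
the factor `1 - q^0 = 0`, so it vanishes). -/
noncomputable def qbin (N n : ℤ) : K2 :=
  if n < 0 then 0
  else ∏ r ∈ Finset.range n.toNat, (1 - q ^ (N - (r : ℤ))) / (1 - q ^ ((r : ℤ) + 1))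

/-- Right-hand side of the finite Jacobi identity: the sum over all `i, j, k ≥ 0`;
terms with `i > L`, `j > L` or `k > L` vanish since the corresponding `qbin` is `0`,
so the ranges below capture the full triple sum. -/
noncomputable def S (L : ℕ) : K2 :=
  ∑ i ∈ Finset.range (L + 1), ∑ j ∈ Finset.range (L + 1), ∑ k ∈ Finset.range (L + 1),
    a ^ ((i : ℤ) - j) * (-1) ^ k * q ^ (T i + T j + T k) *
      qbin ((L : ℤ) - k) i * qbin ((L : ℤ) - i) j * qbin ((L : ℤ) - j) k

/-- Left-hand side of the finite Jacobi identity. -/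
noncomputable def J (L : ℕ) : K2 :=
  ∑ l ∈ Finset.range (L + 1), a ^ (-(l : ℤ)) * ((1 + a ^ (2 * l + 1)) / (1 + a)) * q ^ (T l)

section aux
variable {K : Type*} [Field K]

/-- `(z;z)_n` -/
def fc (z : K) (n : ℤ) : K := ∏ r ∈ Finset.range n.toNat, (1 - z ^ (r + 1))

/-- `1/(z;z)_n`, zero for negative `n` -/
def uu (z : K) (n : ℤ) : K := if n < 0 then 0 else (fc z n)⁻¹

def ww (z : K) (n : ℤ) : K := z ^ (T n) * uu z n

/-- the summand -/
def gg (z : K) (L i j k : ℤ) : K :=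
  ww z i * ww z j * ww z k * fc z (L - i) * fc z (L - j) * fc z (L - k) *
    (uu z (L - i - j) * uu z (L - i - k) * uu z (L - j - k))

lemma fc_step (z : K) (n : ℤ) (hn : 0 ≤ n) : fc z (n + 1) = (1 - z ^ (n + 1)) * fc z n := by
  obtain ⟨m, rfl⟩ := Int.eq_ofNat_of_zero_le hn
  have h1 : ((m : ℤ) + 1).toNat = m + 1 := by omega
  unfold fc
  rw [h1, Finset.prod_range_succ, mul_comm]
  simp only [Int.toNat_natCast]
  norm_cast

lemma fc_zero (z : K) : fc z 0 = 1 := by simp [fc]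

lemma fc_ne (z : K) (hz : ∀ n : ℕ, 0 < n → 1 - z ^ n ≠ 0) (n : ℤ) : fc z n ≠ 0 := by
  unfold fc
  rw [Finset.prod_ne_zero_iff]
  intro r _
  exact hz _ (Nat.succ_pos r)

lemma uu_neg (z : K) (n : ℤ) (hn : n < 0) : uu z n = 0 := by simp [uu, hn]

lemma uu_zero (z : K) : uu z 0 = 1 := by simp [uu, fc_zero]

lemma uu_step (z : K) (hz : ∀ n : ℕ, 0 < n → 1 - z ^ n ≠ 0) (n : ℤ) :
    uu z (n - 1) = (1 - z ^ n) * uu z n := by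
  rcases lt_trichotomy n 0 with h | h | h
  · rw [uu_neg z _ h, uu_neg z _ (by omega), mul_zero]
  · subst h; rw [uu_neg z _ (by omega)]; simp
  · have h1 := fc_step z (n - 1) (by omega)
    have h2 := fc_ne z hz (n - 1)
    have h3 := fc_ne z hz n
    rw [sub_add_cancel] at h1
    rw [uu, uu, if_neg (by omega), if_neg (by omega)]
    rw [h1] at h3 ⊢
    have h4 := left_ne_zero_of_mul h3
    field_simp

lemma fc_uu (z : K) (hz : ∀ n : ℕ, 0 < n → 1 - z ^ n ≠ 0) (n : ℤ) (hn : 0 ≤ n) :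
    fc z n * uu z n = 1 := by
  rw [uu, if_neg (by omega), mul_inv_cancel₀ (fc_ne z hz n)]

lemma T_sub_one (n : ℤ) : T (n - 1) = T n - n := by
  unfold T
  have : n * (n + 1) = (n - 1) * (n - 1 + 1) + n * 2 := by ring
  rw [this, Int.add_mul_ediv_right _ _ (by norm_num)]
  ring

lemma ww_one (z : K) (h0 : z ≠ 0) (hz : ∀ n : ℕ, 0 < n → 1 - z ^ n ≠ 0) (n : ℤ) :
    ww z (n - 1) = ww z n * (z ^ (-n) - 1) := by
  unfold ww
  rw [uu_step z hz, T_sub_one, zpow_sub₀ h0, zpow_neg]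
  have := zpow_ne_zero n h0
  field_simp

lemma ww_two (z : K) (h0 : z ≠ 0) (hz : ∀ n : ℕ, 0 < n → 1 - z ^ n ≠ 0) (n : ℤ) :
    ww z (n - 2) = ww z n * (z ^ (-n) - 1) * (z * z ^ (-n) - 1) := by
  have e : n - 2 = (n - 1) - 1 := by ring
  rw [e, ww_one z h0 hz, ww_one z h0 hz]
  congr 2
  rw [neg_sub, sub_eq_add_neg, zpow_add₀ h0, zpow_one]

lemma ww_neg (z : K) (n : ℤ) (hn : n < 0) : ww z n = 0 := by simp [ww, uu_neg z n hn]

/-- The termwise recurrence. -/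
def Rec (z : K) (L i j k : ℤ) : Prop :=
  gg z L i j k = gg z (L - 1) i j k
    + z ^ L * (gg z (L - 1) (i - 1) j k + gg z (L - 1) i (j - 1) k + gg z (L - 1) i j (k - 1))
    + (z ^ L - z ^ (2 * L - 1)) * (gg z (L - 2) i (j - 1) (k - 1)
        + gg z (L - 2) (i - 1) j (k - 1) + gg z (L - 2) (i - 1) (j - 1) k)
    + z ^ (3 * L - 3) * gg z (L - 3) (i - 1) (j - 1) (k - 1)
    + z ^ (2 * L - 1) * (gg z (L - 3) (i - 2) (j - 1) (k - 1)
        + gg z (L - 3) (i - 1) (j - 2) (k - 1) + gg z (L - 3) (i - 1) (j - 1) (k - 2))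
    + z ^ (3 * L - 3) * gg z (L - 4) (i - 2) (j - 2) (k - 2)

lemma gg_swap (z : K) (L i j k : ℤ) : gg z L i j k = gg z L j i k := by
  unfold gg
  rw [sub_right_comm L i j]; ring

lemma gg_swap' (z : K) (L i j k : ℤ) : gg z L i j k = gg z L k j i := by
  unfold gg
  rw [sub_right_comm L i k, sub_right_comm L i j, sub_right_comm L j k]; ring

lemma Rec_swap (z : K) (L i j k : ℤ) (h : Rec z L j i k) : Rec z L i j k := by
  unfold Rec at *
  simp only [gg_swap z _ j] at h
  rw [gg_swap z _ (j-1), gg_swap z _ (j-1), gg_swap z _ (j-1), gg_swap z _ (j-1), gg_swap z _ (j-1),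
    gg_swap z _ (j-1), gg_swap z _ (j-2), gg_swap z _ (j-2)] at h
  linear_combination h

lemma Rec_swap' (z : K) (L i j k : ℤ) (h : Rec z L k j i) : Rec z L i j k := by
  unfold Rec at *
  simp only [gg_swap' z _ k] at h
  rw [gg_swap' z _ (k-1), gg_swap' z _ (k-1), gg_swap' z _ (k-1), gg_swap' z _ (k-1),
    gg_swap' z _ (k-1), gg_swap' z _ (k-1), gg_swap' z _ (k-2), gg_swap' z _ (k-2)] at h
  linear_combination h

set_option maxHeartbeats 4000000 in
lemma Rec_generic (z : K) (h0 : z ≠ 0) (hz : ∀ n : ℕ, 0 < n → 1 - z ^ n ≠ 0) (L i j k : ℤ)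
    (hi : i ≤ L - 2) (hj : j ≤ L - 2) (hk : k ≤ L - 2) : Rec z L i j k := by
  obtain ⟨P, hP⟩ : ∃ P, P = z ^ (L - 1) := ⟨_, rfl⟩
  have c1 : z ^ L = z * P := by
    rw [hP, ← zpow_one_add₀ h0]; congr 1; ring
  have c2 : z ^ (2 * L - 1) = z * P ^ 2 := by
    rw [hP, ← zpow_natCast, ← zpow_mul, ← zpow_one_add₀ h0]; congr 1; push_cast; ring
  have c3 : z ^ (3 * L - 3) = P ^ 3 := by
    rw [hP, ← zpow_natCast, ← zpow_mul]; congr 1; push_cast; ring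
  have f1 : ∀ n ≤ L - 2, fc z (L - 1 - n) = (1 - P * z ^ (-n)) * fc z (L - 2 - n) := by
    intro n hn
    have := fc_step z (L - 2 - n) (by omega)
    rw [show L - 2 - n + 1 = L - 1 - n by ring] at this
    rw [this, hP, ← zpow_add₀ h0, ← sub_eq_add_neg]
  have f0 : ∀ n ≤ L - 2, fc z (L - n) =
      (1 - z * P * z ^ (-n)) * (1 - P * z ^ (-n)) * fc z (L - 2 - n) := by
    intro n hn
    have := fc_step z (L - 1 - n) (by omega)
    rw [show L - 1 - n + 1 = L - n by ring] at this
    rw [this, f1 n hn, ← c1, ← zpow_add₀ h0, ← sub_eq_add_neg, mul_assoc]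
  have u1 : ∀ m n, uu z (L - 1 - m - n) =
      (1 - z * P * z ^ (-m) * z ^ (-n)) * uu z (L - m - n) := by
    intro m n
    have := uu_step z hz (L - m - n)
    rw [show L - m - n - 1 = L - 1 - m - n by ring] at this
    rw [this, ← c1, ← zpow_add₀ h0, ← zpow_add₀ h0]
    rfl
  have w1 := ww_one z h0 hz
  have w2 := ww_two z h0 hz
  have a1 : ∀ n, L - 1 - (n - 1) = L - n := fun n => by ring
  have a2 : ∀ n, L - 2 - (n - 1) = L - 1 - n := fun n => by ring
  have a3 : ∀ n, L - 3 - (n - 1) = L - 2 - n := fun n => by ring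
  have a4 : ∀ n, L - 3 - (n - 2) = L - 1 - n := fun n => by ring
  have a5 : ∀ n, L - 4 - (n - 2) = L - 2 - n := fun n => by ring
  have b2 : ∀ m n, L - 1 - m - (n - 1) = L - m - n := fun m n => by ring
  have b3 : ∀ m n, L - 2 - m - (n - 1) = L - 1 - m - n := fun m n => by ring
  have b5 : ∀ m n, L - 2 - m - (n - 2) = L - m - n := fun m n => by ring
  unfold Rec gg
  simp only [a1, a2, a3, a4, a5, b2, b3, b5]
  simp only [f1 i hi, f1 j hj, f1 k hk, f0 i hi, f0 j hj, f0 k hk, u1, w1, w2, c1, c2, c3]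
  generalize z ^ (-i) = X
  generalize z ^ (-j) = Y
  generalize z ^ (-k) = Z
  generalize ww z i = d1
  generalize ww z j = d2
  generalize ww z k = d3
  generalize fc z (L - 2 - i) = d4
  generalize fc z (L - 2 - j) = d5
  generalize fc z (L - 2 - k) = d6
  generalize uu z (L - i - j) = d7
  generalize uu z (L - i - k) = d8
  generalize uu z (L - j - k) = d9
  clear f1 f0 u1 w1 w2 a1 a2 a3 a4 a5 b2 b3 b5 c1 c2 c3
  ring

lemma gg_zero (z : K) (L i j k : ℤ)
    (h : i < 0 ∨ j < 0 ∨ k < 0 ∨ L < i + j ∨ L < i + k ∨ L < j + k) : gg z L i j k = 0 := by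
  unfold gg
  rcases h with h | h | h | h | h | h
  · rw [ww_neg z i h]; ring
  · rw [ww_neg z j h]; ring
  · rw [ww_neg z k h]; ring
  · rw [uu_neg z (L - i - j) (by omega)]; ring
  · rw [uu_neg z (L - i - k) (by omega)]; ring
  · rw [uu_neg z (L - j - k) (by omega)]; ring

lemma Rec_zero (z : K) (L i j k : ℤ)
    (h : i < 0 ∨ j < 0 ∨ k < 0 ∨ L < i + j ∨ L < i + k ∨ L < j + k) : Rec z L i j k := by
  unfold Rec
  simp (disch := omega) only [gg_zero]
  ring

lemma Rec_bd (z : K) (h0 : z ≠ 0) (hz : ∀ n : ℕ, 0 < n → 1 - z ^ n ≠ 0) (L i j k : ℤ)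
    (hL : 4 ≤ L) (hi : L - 1 ≤ i) : Rec z L i j k := by
  by_cases h : i < 0 ∨ j < 0 ∨ k < 0 ∨ L < i + j ∨ L < i + k ∨ L < j + k
  · exact Rec_zero z L i j k h
  push Not at h
  have c1 : (i = L ∧ j = 0 ∧ k = 0) ∨ (i = L - 1 ∧ j = 0 ∧ k = 0) ∨ (i = L - 1 ∧ j = 1 ∧ k = 0)
     ∨ (i = L - 1 ∧ j = 0 ∧ k = 1) ∨ (i = L - 1 ∧ j = 1 ∧ k = 1) := by omega
  have T0 : T 0 = 0 := by decide
  have T1 : T 1 = 1 := by decide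
  have f1 : fc z 1 = 1 - z := by simp [fc]
  have u1 : uu z 1 = (1 - z)⁻¹ := by simp [uu, f1]
  have n1 : 1 - z ≠ 0 := by simpa using hz 1 one_pos
  have w0 : ww z 0 = 1 := by simp [ww, T0, uu_zero]
  have w1 : ww z 1 = z * (1 - z)⁻¹ := by simp [ww, T1, u1]
  obtain ⟨R, hR⟩ : ∃ R, R = z ^ (-3 + L) := ⟨_, rfl⟩
  have R0 : R ≠ 0 := hR ▸ zpow_ne_zero _ h0
  have e0 : z ^ L = z ^ 3 * R := by
    rw [hR, ← zpow_natCast z 3, ← zpow_add₀ h0]; congr 1; push_cast; ring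
  have e1 : z ^ (-1 + L) = z ^ 2 * R := by
    rw [hR, ← zpow_natCast z 2, ← zpow_add₀ h0]; congr 1; push_cast; ring
  have e2 : z ^ (-2 + L) = z * R := by
    rw [hR, ← zpow_one_add₀ h0]; congr 1; ring
  have e3 : z ^ (-1 + L * 2) = z ^ 5 * R ^ 2 := by
    rw [hR, ← zpow_natCast z 5, ← zpow_natCast _ 2, ← zpow_mul, ← zpow_add₀ h0]
    congr 1; push_cast; ring
  have p2 : fc z (-2 + L) = (1 - z * R) * fc z (-3 + L) := by
    have := fc_step z (-3 + L) (by omega)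
    rwa [show -3 + L + 1 = -2 + L by ring, e2] at this
  have p1 : fc z (-1 + L) = (1 - z ^ 2 * R) * ((1 - z * R) * fc z (-3 + L)) := by
    have := fc_step z (-2 + L) (by omega)
    rwa [show -2 + L + 1 = -1 + L by ring, e1, p2] at this
  have p0 : fc z L = (1 - z ^ 3 * R) * ((1 - z ^ 2 * R) * ((1 - z * R) * fc z (-3 + L))) := by
    have := fc_step z (-1 + L) (by omega)
    rwa [show -1 + L + 1 = L by ring, e0, p1] at this
  have q1 : uu z (-1 + L) = (1 - z ^ 3 * R) * uu z L := by
    have := uu_step z hz L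
    rwa [show L - 1 = -1 + L by ring, e0] at this
  have q2 : uu z (-2 + L) = (1 - z ^ 2 * R) * ((1 - z ^ 3 * R) * uu z L) := by
    have := uu_step z hz (-1 + L)
    rwa [show -1 + L - 1 = -2 + L by ring, e1, q1] at this
  have q3 : uu z (-3 + L) = (1 - z * R) * ((1 - z ^ 2 * R) * ((1 - z ^ 3 * R) * uu z L)) := by
    have := uu_step z hz (-2 + L)
    rwa [show -2 + L - 1 = -3 + L by ring, e2, q2] at this
  have v1 : ww z (-1 + L) = ww z L * ((z ^ 3 * R)⁻¹ - 1) := by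
    have := ww_one z h0 hz L
    rwa [show L - 1 = -1 + L by ring, zpow_neg, e0] at this
  have v2 : ww z (-2 + L) = ww z L * ((z ^ 3 * R)⁻¹ - 1) * ((z ^ 2 * R)⁻¹ - 1) := by
    have := ww_one z h0 hz (-1 + L)
    rwa [show -1 + L - 1 = -2 + L by ring, zpow_neg, e1, v1] at this
  have v3 : ww z (-3 + L) = ww z L * ((z ^ 3 * R)⁻¹ - 1) * ((z ^ 2 * R)⁻¹ - 1)
      * ((z * R)⁻¹ - 1) := by
    have := ww_one z h0 hz (-2 + L)
    rwa [show -2 + L - 1 = -3 + L by ring, zpow_neg, e2, v2] at this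
  unfold Rec
  have hLi : ∃ M, M = L := ⟨_, rfl⟩
  obtain ⟨M, hM⟩ := hLi
  rcases c1 with ⟨hi', rfl, rfl⟩ | ⟨rfl, rfl, rfl⟩ | ⟨rfl, rfl, rfl⟩ | ⟨rfl, rfl, rfl⟩ |
    ⟨rfl, rfl, rfl⟩
  · rw [hi']
    simp (disch := omega) only [gg_zero, mul_zero, add_zero, zero_add]
    unfold gg
    ring_nf
    simp only [w0, uu_zero, fc_zero, e0, p0, p1, q1, v1]
    field_simp
  all_goals
    simp (disch := omega) only [gg_zero, mul_zero, add_zero, zero_add]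
    unfold gg
    ring_nf
    simp only [w0, w1, uu_zero, fc_zero, u1, f1, e0, e3, p0, p1, p2, q1, q2, q3, v1, v2, v3]
    field_simp
    ring

lemma Rec_all (z : K) (h0 : z ≠ 0) (hz : ∀ n : ℕ, 0 < n → 1 - z ^ n ≠ 0) (L i j k : ℤ)
    (hL : 4 ≤ L) : Rec z L i j k := by
  by_cases hi : L - 1 ≤ i
  · exact Rec_bd z h0 hz L i j k hL hi
  by_cases hj : L - 1 ≤ j
  · exact Rec_swap z L i j k (Rec_bd z h0 hz L j i k hL hj)
  by_cases hk : L - 1 ≤ k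
  · exact Rec_swap' z L i j k (Rec_bd z h0 hz L k j i hL hk)
  exact Rec_generic z h0 hz L i j k (by omega) (by omega) (by omega)

/-- weighted summand -/
def tm (z b : K) (L : ℤ) (x : ℤ × ℤ × ℤ) : K :=
  b ^ (x.1 - x.2.1) * (-1) ^ x.2.2 * gg z L x.1 x.2.1 x.2.2

noncomputable def FF (z b : K) (L : ℤ) : K := ∑ᶠ x : ℤ × ℤ × ℤ, tm z b L x

lemma tm_shift (z b : K) (L M α β γ : ℤ) (hM : L + 10 ≤ M) (h1 : |α| ≤ 5) (h2 : |β| ≤ 5)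
    (h3 : |γ| ≤ 5) :
    ∑ x ∈ Finset.Icc (-M) M ×ˢ Finset.Icc (-M) M ×ˢ Finset.Icc (-M) M,
      tm z b L (x - (α, β, γ)) = FF z b L := by
  unfold FF
  rw [← finsum_comp_equiv (Equiv.subRight ((α, β, γ) : ℤ × ℤ × ℤ)),
    finsum_eq_sum_of_support_subset]
  · rfl
  · intro x hx
    rw [Function.mem_support] at hx
    have h : ¬ _ := fun h => hx (show tm z b L (x - (α, β, γ)) = 0 by
      unfold tm; rw [gg_zero z L _ _ _ h, mul_zero])
    obtain ⟨i, j, k⟩ := x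
    simp only [Prod.mk_sub_mk] at h
    rw [abs_le] at *
    simp only [Finset.coe_product, Finset.coe_Icc, Set.mem_prod, Set.mem_Icc]
    omega

lemma FF_rec (z b : K) (h0 : z ≠ 0) (hz : ∀ n : ℕ, 0 < n → 1 - z ^ n ≠ 0) (hb : b ≠ 0) (L : ℤ)
    (hL : 4 ≤ L) :
    FF z b L = FF z b (L - 1) + z ^ L * (b + b⁻¹ - 1) * FF z b (L - 1)
      + (z ^ L - z ^ (2 * L - 1)) * (1 - b - b⁻¹) * FF z b (L - 2)
      - z ^ (3 * L - 3) * FF z b (L - 3)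
      - z ^ (2 * L - 1) * (b + b⁻¹ - 1) * FF z b (L - 3)
      + z ^ (3 * L - 3) * FF z b (L - 4) := by
  have key : ∀ x : ℤ × ℤ × ℤ, tm z b L (x - (0, 0, 0)) = tm z b (L - 1) (x - (0, 0, 0))
    + z ^ L * (b * tm z b (L - 1) (x - (1, 0, 0)) + b⁻¹ * tm z b (L - 1) (x - (0, 1, 0))
        - tm z b (L - 1) (x - (0, 0, 1)))
    + (z ^ L - z ^ (2 * L - 1)) * (- b⁻¹ * tm z b (L - 2) (x - (0, 1, 1))
        - b * tm z b (L - 2) (x - (1, 0, 1)) + tm z b (L - 2) (x - (1, 1, 0)))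
    - z ^ (3 * L - 3) * tm z b (L - 3) (x - (1, 1, 1))
    - z ^ (2 * L - 1) * (b * tm z b (L - 3) (x - (2, 1, 1)) + b⁻¹ * tm z b (L - 3) (x - (1, 2, 1))
      - tm z b (L - 3) (x - (1, 1, 2)))
    + z ^ (3 * L - 3) * tm z b (L - 4) (x - (2, 2, 2)) := by
    rintro ⟨i, j, k⟩
    have h := Rec_all z h0 hz L i j k hL
    unfold Rec at h
    have hm : (-1 : K) ≠ 0 := by simp
    simp only [tm, Prod.mk_sub_mk, sub_zero]
    rw [h]
    simp only [zpow_sub₀ hb, zpow_sub₀ hm, zpow_ofNat]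
    have := zpow_ne_zero i hb
    have := zpow_ne_zero j hb
    field_simp
    ring
  have hs := Finset.sum_congr (rfl : Finset.Icc (-(L + 10)) (L + 10) ×ˢ
    Finset.Icc (-(L + 10)) (L + 10) ×ˢ Finset.Icc (-(L + 10)) (L + 10) = _) (fun x _ => key x)
  simp only [Finset.sum_add_distrib, Finset.sum_sub_distrib, ← Finset.mul_sum] at hs
  simp (disch := first | omega | simp) only [tm_shift] at hs
  rw [hs]
  ring

lemma FF_eq (z b : K) (L : ℕ) : FF z b L =
    ∑ i ∈ Finset.range (L + 1), ∑ j ∈ Finset.range (L + 1), ∑ k ∈ Finset.range (L + 1),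
      b ^ ((i : ℤ) - j) * (-1) ^ k * gg z L i j k := by
  let e : ℕ ↪ ℤ := Nat.castEmbedding
  have : FF z b L = ∑ x ∈ ((Finset.range (L + 1)).map e) ×ˢ ((Finset.range (L + 1)).map e) ×ˢ
      ((Finset.range (L + 1)).map e), tm z b L x := by
    unfold FF
    apply finsum_eq_sum_of_support_subset
    rintro ⟨i, j, k⟩ hx
    rw [Function.mem_support] at hx
    have h : ¬ _ := fun h => hx (show tm z b L (i, j, k) = 0 by
      unfold tm; rw [gg_zero z L _ _ _ h, mul_zero])
    dsimp only at h
    simp only [Finset.mem_coe, Finset.mem_product, Finset.mem_map, Finset.mem_range, e,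
      Nat.castEmbedding_apply]
    exact ⟨⟨i.toNat, by omega, by omega⟩, ⟨j.toNat, by omega, by omega⟩,
      ⟨k.toNat, by omega, by omega⟩⟩
  rw [this]
  simp only [Finset.sum_product, Finset.sum_map, e, Nat.castEmbedding_apply, tm, zpow_natCast]

end aux

lemma q_ne : q ≠ 0 := by
  intro h
  have h1 : (RatFunc.X : K2) = 0 := h
  rw [← RatFunc.algebraMap_X, ← map_zero (algebraMap (Polynomial (Polynomial ℚ)) K2)] at h1
  exact Polynomial.X_ne_zero (RatFunc.algebraMap_injective _ h1)

lemma q_pow_ne (n : ℕ) (hn : 0 < n) : 1 - q ^ n ≠ 0 := by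
  intro h
  have h1 : (RatFunc.X : K2) ^ n = 1 := (sub_eq_zero.mp h).symm
  rw [← RatFunc.algebraMap_X, ← map_pow, ← map_one (algebraMap (Polynomial (Polynomial ℚ)) K2)] at h1
  have h2 := RatFunc.algebraMap_injective _ h1
  have h3 := congrArg Polynomial.natDegree h2
  simp at h3
  omega

lemma a_ne : a ≠ 0 := by
  unfold a
  rw [Ne, map_eq_zero_iff _ RatFunc.C_injective]
  exact Polynomial.X_ne_zero

lemma one_add_a_ne : 1 + a ≠ 0 := by
  unfold a
  rw [← map_one (RatFunc.C : Polynomial ℚ →+* _), ← map_add, Ne,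
    map_eq_zero_iff _ RatFunc.C_injective]
  intro h
  have := congrArg (Polynomial.eval 0) h
  simp at this

lemma qbin_eq (N : ℤ) (hN : 0 ≤ N) (n : ℕ) : qbin N n = fc q N * uu q n * uu q (N - n) := by
  have hq : ∀ n : ℕ, 0 < n → 1 - q ^ n ≠ 0 := q_pow_ne
  have e : qbin N n = ∏ r ∈ Finset.range n, (1 - q ^ (N - (r : ℤ))) / (1 - q ^ ((r : ℤ) + 1)) := by
    unfold qbin
    rw [if_neg (by omega), Int.toNat_natCast]
  rw [e]
  clear e
  induction n with
  | zero => simp [uu_zero, fc_uu q hq N hN]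
  | succ n ih =>
    rw [Finset.prod_range_succ, ih]
    have h1 := uu_step q hq (n + 1)
    have h2 := uu_step q hq (N - n)
    rw [add_sub_cancel_right] at h1
    push_cast
    rw [show N - ((n : ℤ) + 1) = N - n - 1 by ring, h1, h2]
    have h3 : 1 - q ^ ((n : ℤ) + 1) ≠ 0 := by exact_mod_cast hq (n + 1) (by omega)
    field_simp

lemma S_eq (L : ℕ) : S L = FF q a L := by
  rw [FF_eq]
  unfold S
  refine Finset.sum_congr rfl fun i hi => Finset.sum_congr rfl fun j hj =>
    Finset.sum_congr rfl fun k hk => ?_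
  rw [Finset.mem_range] at hi hj hk
  rw [qbin_eq _ (by omega), qbin_eq _ (by omega), qbin_eq _ (by omega)]
  unfold gg ww
  rw [zpow_add₀ q_ne, zpow_add₀ q_ne, sub_right_comm (L : ℤ) k i]
  ring

lemma S_rec (n : ℕ) :
    S (n + 4) = S (n + 3) + q ^ (n + 4) * (a + a⁻¹ - 1) * S (n + 3)
      + (q ^ (n + 4) - q ^ (2 * n + 7)) * (1 - a - a⁻¹) * S (n + 2)
      - q ^ (3 * n + 9) * S (n + 1)
      - q ^ (2 * n + 7) * (a + a⁻¹ - 1) * S (n + 1)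
      + q ^ (3 * n + 9) * S n := by
  have h := FF_rec q a q_ne q_pow_ne a_ne (n + 4 : ℤ) (by omega)
  simp only [S_eq]
  push_cast
  rw [show (n : ℤ) + 4 - 1 = n + 3 by ring, show (n : ℤ) + 4 - 2 = n + 2 by ring,
    show (n : ℤ) + 4 - 3 = n + 1 by ring, show (n : ℤ) + 4 - 4 = n by ring,
    show 2 * ((n : ℤ) + 4) - 1 = (2 * n + 7 : ℕ) by push_cast; ring,
    show 3 * ((n : ℤ) + 4) - 3 = (3 * n + 9 : ℕ) by push_cast; ring] at h
  rw [h]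
  simp only [zpow_natCast]
  norm_cast

lemma J_succ (n : ℕ) : J (n + 1) = J n + a ^ (-((n + 1 : ℕ) : ℤ)) *
    ((1 + a ^ (2 * (n + 1) + 1)) / (1 + a)) * q ^ (T ((n + 1 : ℕ) : ℤ)) := by
  unfold J
  rw [Finset.sum_range_succ]

lemma T_add_one (n : ℤ) : T (n + 1) = T n + (n + 1) := by
  have := T_sub_one (n + 1)
  rw [add_sub_cancel_right] at this
  omega

lemma J_rec (n : ℕ) :
    J (n + 4) = J (n + 3) + q ^ (n + 4) * (a + a⁻¹ - 1) * J (n + 3)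
      + (q ^ (n + 4) - q ^ (2 * n + 7)) * (1 - a - a⁻¹) * J (n + 2)
      - q ^ (3 * n + 9) * J (n + 1)
      - q ^ (2 * n + 7) * (a + a⁻¹ - 1) * J (n + 1)
      + q ^ (3 * n + 9) * J n := by
  have ha := a_ne
  have ha1 := one_add_a_ne
  have hq := q_ne
  have t1 : q ^ (T ((n + 1 : ℕ) : ℤ)) = q ^ (T n) * q ^ (n + 1) := by
    push_cast
    rw [T_add_one, zpow_add₀ hq]; norm_cast
  have t2 : q ^ (T ((n + 1 + 1 : ℕ) : ℤ)) = q ^ (T n) * q ^ (n + 1) * q ^ (n + 2) := by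
    rw [← t1]; push_cast
    rw [T_add_one, zpow_add₀ hq]; norm_cast
  have t3 : q ^ (T ((n + 2 + 1 : ℕ) : ℤ)) = q ^ (T n) * q ^ (n + 1) * q ^ (n + 2) * q ^ (n + 3) := by
    rw [← t2]; push_cast
    rw [T_add_one, zpow_add₀ hq]; norm_cast
  have t4 : q ^ (T ((n + 3 + 1 : ℕ) : ℤ)) =
      q ^ (T n) * q ^ (n + 1) * q ^ (n + 2) * q ^ (n + 3) * q ^ (n + 4) := by
    rw [← t3]; push_cast
    rw [T_add_one, zpow_add₀ hq]; norm_cast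
  rw [J_succ (n + 3), J_succ (n + 2), J_succ (n + 1), J_succ n, t1, t2, t3, t4]
  simp only [zpow_neg, zpow_natCast]
  generalize q ^ (T n) = t
  generalize J n = j
  have han := pow_ne_zero n ha
  simp only [pow_add, pow_mul', mul_add]
  field_simp
  ring

lemma qbin_n_zero (N : ℤ) : qbin N 0 = 1 := by simp [qbin]

lemma base0 : J 0 = S 0 := by
  have h := one_add_a_ne
  simp [J, S, qbin, T, h]

lemma qbin_one (N : ℤ) : qbin N 1 = (1 - q ^ N) / (1 - q) := by
  simp [qbin]

lemma qbin_two (N : ℤ) : qbin N 2 = (1 - q ^ N) / (1 - q) * ((1 - q ^ (N - 1)) / (1 - q ^ 2)) := by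
  simp [qbin, Finset.prod_range_succ]
  norm_cast
  simp only [div_mul_div_comm]

lemma qbin_three (N : ℤ) : qbin N 3 = (1 - q ^ N) / (1 - q) * ((1 - q ^ (N - 1)) / (1 - q ^ 2)) *
    ((1 - q ^ (N - 2)) / (1 - q ^ 3)) := by
  simp [qbin, Finset.prod_range_succ]
  norm_cast
  simp only [div_mul_div_comm]

lemma base1 : J 1 = S 1 := by
  have h := one_add_a_ne
  have h0 := a_ne
  have h1 : 1 - q ≠ 0 := by simpa using q_pow_ne 1 (by norm_num)
  have T1 : T 1 = 1 := by decide
  have T0 : T 0 = 0 := by decide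
  simp [J, S, Finset.sum_range_succ, qbin_n_zero, qbin_one, T0, T1]
  field_simp
  ring

lemma base2 : J 2 = S 2 := by
  have h := one_add_a_ne
  have h0 := a_ne
  have hq := q_ne
  have h1 : 1 - q ≠ 0 := by simpa using q_pow_ne 1 (by norm_num)
  have h2 : 1 - q ^ 2 ≠ 0 := q_pow_ne 2 (by norm_num)
  have T1 : T 1 = 1 := by decide
  have T0 : T 0 = 0 := by decide
  have T2 : T 2 = 3 := by decide
  have b11 : qbin 1 1 = 1 := by rw [qbin_one]; simp [h1]
  have b21 : qbin 2 1 = 1 + q := by rw [qbin_one, zpow_ofNat]; field_simp; ring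
  have b01 : qbin 0 1 = 0 := by rw [qbin_one]; simp
  have b02 : qbin 0 2 = 0 := by rw [qbin_two]; simp
  have b12 : qbin 1 2 = 0 := by rw [qbin_two]; simp
  have b22 : qbin 2 2 = 1 := by rw [qbin_two]; norm_num; norm_cast; field_simp
  norm_num [J, S, Finset.sum_range_succ, qbin_n_zero, T0, T1, T2, b11, b21, b01, b02, b12, b22,
    zpow_ofNat, zpow_neg]
  field_simp
  ring

lemma base3 : J 3 = S 3 := by
  have h := one_add_a_ne
  have h0 := a_ne
  have hq := q_ne
  have h1 : 1 - q ≠ 0 := by simpa using q_pow_ne 1 (by norm_num)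
  have h2 : 1 - q ^ 2 ≠ 0 := q_pow_ne 2 (by norm_num)
  have h3 : 1 - q ^ 3 ≠ 0 := q_pow_ne 3 (by norm_num)
  have T1 : T 1 = 1 := by decide
  have T0 : T 0 = 0 := by decide
  have T2 : T 2 = 3 := by decide
  have T3 : T 3 = 6 := by decide
  have b11 : qbin 1 1 = 1 := by rw [qbin_one]; simp [h1]
  have b21 : qbin 2 1 = 1 + q := by rw [qbin_one, zpow_ofNat]; field_simp; ring
  have b31 : qbin 3 1 = 1 + q + q ^ 2 := by rw [qbin_one, zpow_ofNat]; field_simp; ring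
  have b01 : qbin 0 1 = 0 := by rw [qbin_one]; simp
  have b02 : qbin 0 2 = 0 := by rw [qbin_two]; simp
  have b12 : qbin 1 2 = 0 := by rw [qbin_two]; simp
  have b22 : qbin 2 2 = 1 := by rw [qbin_two]; norm_num; norm_cast; field_simp
  have b32 : qbin 3 2 = 1 + q + q ^ 2 := by rw [qbin_two]; norm_num; norm_cast; field_simp; ring
  have b03 : qbin 0 3 = 0 := by rw [qbin_three]; simp
  have b13 : qbin 1 3 = 0 := by rw [qbin_three]; simp
  have b23 : qbin 2 3 = 0 := by rw [qbin_three]; simp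
  have b33 : qbin 3 3 = 1 := by rw [qbin_three]; norm_num; norm_cast; field_simp
  norm_num [J, S, Finset.sum_range_succ, qbin_n_zero, T0, T1, T2, T3, b11, b21, b01, b02, b12, b22,
    b31, b32, b03, b13, b23, b33, zpow_ofNat, zpow_neg]
  field_simp
  ring

/-- Finite analog of Jacobi'"'"'s formula, identity (5.6) of Alladi–Berkovich. -/
theorem finite_jacobi (L : ℕ) : J L = S L := by
  induction L using Nat.strong_induction_on with
  | _ L ih =>
    match L, ih with
    | 0, _ => exact base0
    | 1, _ => exact base1
    | 2, _ => exact base2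
    | 3, _ => exact base3
    | n + 4, ih =>
      rw [J_rec, S_rec, ih n (by omega), ih (n + 1) (by omega), ih (n + 2) (by omega),
        ih (n + 3) (by omega)]
end

section
/- Göllnitz's partition theorem: for every nonnegative integer N, the number of partitions N = n₁ + n₂ + n₃ + ⋯ (n₁ ≥ n₂ ≥ ⋯) with no part equal to 1 or 3 and n_i - n_{i+1} ≥ 6, with strict inequality whenever n_i ≡ 0, 1, or 3 (mod 6), equals the number of partitions of N into distinct parts congruent to 2, 4, or 5 modulo 6. -/
namespace Gollnitz

open PowerSeries

/-- The base ring of power series in `q`. -/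
abbrev R := PowerSeries ℚ
/-- Power series in the auxiliary variable over `R`. -/
abbrev RX := PowerSeries R

/-- The variable `q`. -/
noncomputable def q : R := PowerSeries.X
/-- `t = q ^ 6`. -/
noncomputable def t : R := q ^ 6

/-- The exponent `6 * n.choose 2`. -/
def ex : ℕ → ℕ
  | 0 => 0
  | n + 1 => ex n + 6 * n

lemma ex_ge (n : ℕ) : n ≤ ex n + 1 := by
  induction n with
  | zero => simp
  | succ n ih => simp only [ex]; omega

/-- Truncation of the functional `X ^ n ↦ t ^ (n.choose 2)`. -/
noncomputable def LK (K : ℕ) (f : RX) : R := ∑ n ∈ Finset.range K, coeff n f * q ^ ex n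

/-- The functional `X ^ n ↦ t ^ (n.choose 2)`. -/
noncomputable def L (f : RX) : R := PowerSeries.mk fun N => coeff N (LK (N + 2) f)

lemma coeff_LK (N : ℕ) (f : RX) (K : ℕ) (h : N + 2 ≤ K) :
    coeff N (LK K f) = coeff N (LK (N + 2) f) := by
  induction K, h using Nat.le_induction with
  | base => rfl
  | succ K hK ih =>
    rw [← ih]
    unfold LK
    rw [Finset.sum_range_succ, map_add, q, PowerSeries.coeff_mul_X_pow', if_neg, add_zero]
    have := ex_ge K
    omega

lemma coeff_L (N : ℕ) (f : RX) (K : ℕ) (h : N + 2 ≤ K) :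
    coeff N (L f) = coeff N (LK K f) := by
  rw [coeff_LK N f K h, L, PowerSeries.coeff_mk]

lemma L_add (f g : RX) : L (f + g) = L f + L g := by
  ext N
  rw [map_add, coeff_L N _ _ le_rfl, coeff_L N _ _ le_rfl, coeff_L N _ _ le_rfl, ← map_add]
  congr 1
  simp [LK, add_mul, Finset.sum_add_distrib]

lemma L_C_mul (r : R) (f : RX) : L (C r * f) = r * L f := by
  ext N
  rw [coeff_L N _ (N + 2) le_rfl]
  have : LK (N + 2) (C r * f) = r * LK (N + 2) f := by
    simp [LK, Finset.mul_sum, mul_assoc]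
  rw [this, PowerSeries.coeff_mul, PowerSeries.coeff_mul]
  refine Finset.sum_congr rfl fun p hp => ?_
  have hp := Finset.HasAntidiagonal.mem_antidiagonal.1 hp
  rw [coeff_L p.2 f (N + 2) (by omega)]

lemma L_sub (f g : RX) : L (f - g) = L f - L g := by
  have : f - g = f + C (-1) * g := by simp [sub_eq_add_neg]
  rw [this, L_add, L_C_mul]; ring

lemma L_X_mul (f : RX) : L (X * f) = L (rescale t f) := by
  ext N
  rw [coeff_L N _ (N + 3) (by omega), coeff_L N _ (N + 2) le_rfl]
  congr 1
  unfold LK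
  rw [Finset.sum_range_succ']
  simp only [coeff_succ_X_mul, coeff_zero_X_mul, zero_mul, add_zero, coeff_rescale, ex, t]
  refine Finset.sum_congr rfl fun n _ => ?_
  ring

lemma L_one : L 1 = 1 := by
  ext N
  rw [coeff_L N _ (N + 2) le_rfl]
  congr 1
  unfold LK
  rw [Finset.sum_range_succ']
  simp [coeff_one, ex]

/-- Reduction modulo `q ^ M`. -/
noncomputable def pr (M : ℕ) : R →+* R ⧸ Ideal.span {q ^ M} := Ideal.Quotient.mk _

lemma pr_eq_iff (M : ℕ) (x y : R) : pr M x = pr M y ↔ ∀ N < M, coeff N x = coeff N y := by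
  rw [pr, Ideal.Quotient.eq, Ideal.mem_span_singleton, q, PowerSeries.X_pow_dvd_iff]
  simp [sub_eq_zero]

lemma L_congr (M : ℕ) (f g : RX) (h : PowerSeries.map (pr M) f = PowerSeries.map (pr M) g) :
    pr M (L f) = pr M (L g) := by
  rw [pr_eq_iff]
  intro N hN
  rw [coeff_L N _ (N + 2) le_rfl, coeff_L N _ (N + 2) le_rfl]
  have : pr M (LK (N + 2) f) = pr M (LK (N + 2) g) := by
    simp only [LK, map_sum, map_mul]
    refine Finset.sum_congr rfl fun n _ => ?_
    have := congrArg (coeff n) h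
    simp only [PowerSeries.coeff_map] at this
    rw [this]
  exact (pr_eq_iff M _ _).1 this N hN

/-- `∑ X ^ n / (t; t)_n`, i.e. the inverse of `(X; t)_∞`. -/
noncomputable def E0 : RX := PowerSeries.mk fun n => (∏ k ∈ Finset.range n, (1 - t ^ (k + 1)))⁻¹

lemma const_ne (n : ℕ) : constantCoeff (∏ k ∈ Finset.range n, (1 - t ^ (k + 1))) ≠ 0 := by
  simp [t, q]

lemma E0_rec : rescale t E0 = (1 - X) * E0 := by
  ext1 n
  cases n with
  | zero => simp [sub_mul]
  | succ n =>
    rw [sub_mul, one_mul, map_sub, coeff_succ_X_mul, coeff_rescale]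
    simp only [E0, coeff_mk]
    have h1 := PowerSeries.mul_inv_cancel _ (const_ne (n + 1))
    have h2 := PowerSeries.mul_inv_cancel _ (const_ne n)
    rw [Finset.prod_range_succ] at h1 ⊢
    set A := ∏ k ∈ Finset.range n, (1 - t ^ (k + 1))
    set u := (A * (1 - t ^ (n + 1)))⁻¹
    set v := A⁻¹
    linear_combination (-v) * h1 + (1 - t ^ (n + 1)) * u * h2

lemma exists_e0 : ∃ e : RX, E0 * e = 1 ∧ constantCoeff e = 1 := by
  have h0 : constantCoeff E0 = 1 := by
    rw [← PowerSeries.coeff_zero_eq_constantCoeff_apply]; simp [E0]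
  have : IsUnit E0 := by
    rw [PowerSeries.isUnit_iff_constantCoeff, h0]; exact isUnit_one
  obtain ⟨e, he⟩ := this.exists_right_inv
  refine ⟨e, he, ?_⟩
  have := congrArg constantCoeff he
  simpa [h0] using this

/-- The inverse of `E0`. -/
noncomputable def e0 : RX := exists_e0.choose

lemma E0_e0 : E0 * e0 = 1 := exists_e0.choose_spec.1

lemma e0_rec : e0 = (1 - X) * rescale t e0 := by
  have h := congrArg (rescale t) E0_e0
  rw [map_mul, E0_rec, map_one] at h
  calc e0 = e0 * ((1 - X) * E0 * rescale t e0) := by rw [h, mul_one]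
    _ = (E0 * e0) * ((1 - X) * rescale t e0) := by ring
    _ = _ := by rw [E0_e0, one_mul]

/-- `1 / (a X; t)_∞`. -/
noncomputable def E (a : R) : RX := rescale a E0
/-- `(-a X; t)_∞`. -/
noncomputable def e (a : R) : RX := rescale (-a) e0

lemma E_t (a : R) : E (t * a) = (1 - C a * X) * E a := by
  have := congrArg (rescale a) E0_rec
  rw [PowerSeries.rescale_rescale, map_mul, map_sub, map_one, PowerSeries.rescale_X] at this
  rw [E, E, mul_comm t a, ← this, mul_comm]

lemma e_t (a : R) : e a = (1 + C a * X) * e (t * a) := by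
  have := congrArg (rescale (-a)) e0_rec
  rw [map_mul, PowerSeries.rescale_rescale, map_sub, map_one, PowerSeries.rescale_X] at this
  rw [e, this, e]
  simp

lemma rescale_E (a : R) : rescale t (E a) = E (t * a) := by
  rw [E, E, PowerSeries.rescale_rescale, mul_comm]

lemma rescale_e (a : R) : rescale t (e a) = e (t * a) := by
  rw [e, e, PowerSeries.rescale_rescale]; congr 2; ring

/-- The weight. -/
noncomputable def W (a b c : R) : RX := E a * E b * E c * e (a * b) * e (a * c) * e (b * c)

/-- The quantity of the key identity. -/
noncomputable def F (a b c d : R) : R := L ((1 + C d * X ^ 2) * W a b c)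

lemma F_step (a b c β : R) (h : b * c = t * β) :
    F a b c (a * β) = (1 + a) * F (t * a) b c (t * a * β) := by
  have key : (1 + C (a * β) * X ^ 2) * W a b c
      - C (1 + a) * ((1 + C (t * a * β) * X ^ 2) * W (t * a) b c)
      = X * (C a * ((1 + C β * X) * W a b c)) -
        rescale t (C a * ((1 + C β * X) * W a b c)) := by
    have hr : rescale t (C a : RX) = C a := by
      ext1 n
      rw [coeff_rescale, coeff_C]
      split_ifs with h0
      · rw [h0, pow_zero, one_mul]
      · rw [mul_zero]
    have hr2 : rescale t (C β : RX) = C β := by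
      ext1 n
      rw [coeff_rescale, coeff_C]
      split_ifs with h0
      · rw [h0, pow_zero, one_mul]
      · rw [mul_zero]
    simp only [map_mul, map_add, map_one, hr, hr2, PowerSeries.rescale_X, W, rescale_E, rescale_e]
    rw [E_t a, E_t b, E_t c, e_t (a * b), e_t (a * c), e_t (b * c),
      show t * a * b = t * (a * b) by ring, show t * a * c = t * (a * c) by ring]
    have h' : (C b : RX) * C c = C t * C β := by rw [← map_mul, h, map_mul]
    simp only [map_mul]
    generalize (C a : RX) = A at *
    generalize (C b : RX) = B at *
    generalize (C c : RX) = D at *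
    generalize (C β : RX) = Z at *
    generalize (C t : RX) = T at *
    generalize E a = x1
    generalize E b = x2
    generalize E c = x3
    generalize e (t * (a * b)) = x4
    generalize e (t * (a * c)) = x5
    generalize e (t * (b * c)) = x6
    linear_combination (-(-(1 + A) * A * X ^ 2 * (1 - A * X) * (1 + B * D * X)
      + A * X * (1 - A * X) * (1 - B * X) * (1 - D * X)) * (x1 * x2 * x3 * x4 * x5 * x6)) * h'
  have := congrArg L key
  rw [L_sub, L_sub, L_X_mul, sub_self, L_C_mul] at this
  exact sub_eq_zero.1 this

lemma F_iter (a b c β : R) (h : b * c = t * β) (M : ℕ) :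
    F a b c (a * β) = (∏ i ∈ Finset.range M, (1 + t ^ i * a)) *
      F (t ^ M * a) b c (t ^ M * a * β) := by
  induction M with
  | zero => simp
  | succ M ih =>
    rw [ih, F_step _ b c β h, Finset.prod_range_succ]
    rw [show t * (t ^ M * a) = t ^ (M + 1) * a by ring]
    ring

lemma map_rescale {S : Type*} [CommRing S] (φ : R →+* S) (a : R) (f : RX) :
    PowerSeries.map φ (rescale a f) = rescale (φ a) (PowerSeries.map φ f) := by
  ext n; simp [coeff_rescale]

lemma map_E {S : Type*} [CommRing S] (φ : R →+* S) (a b : R) (h : φ a = φ b) :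
    PowerSeries.map φ (E a) = PowerSeries.map φ (E b) := by
  rw [E, E, map_rescale, map_rescale, h]

lemma map_e {S : Type*} [CommRing S] (φ : R →+* S) (a b : R) (h : φ a = φ b) :
    PowerSeries.map φ (e a) = PowerSeries.map φ (e b) := by
  rw [e, e, map_rescale, map_rescale, map_neg, map_neg, h]

lemma map_W {S : Type*} [CommRing S] (φ : R →+* S) (a b c β : R) (h : φ a = 0) :
    PowerSeries.map φ ((1 + C (a * β) * X ^ 2) * W a b c) =
      PowerSeries.map φ ((1 + C 0 * X ^ 2) * W 0 b c) := by
  have h0 : ∀ x, φ (a * x) = φ (0 * x) := fun x => by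
    rw [map_mul, h, zero_mul, zero_mul, map_zero]
  simp only [map_mul, map_add, W]
  rw [map_E φ a 0 (by rw [h, map_zero]), map_e φ _ _ (h0 b), map_e φ _ _ (h0 c)]
  simp [h]

lemma E_zero : E 0 = 1 := by
  have h0 : constantCoeff E0 = 1 := by
    rw [← PowerSeries.coeff_zero_eq_constantCoeff_apply]; simp [E0]
  simp [E, PowerSeries.rescale_zero, h0]

lemma e_zero : e 0 = 1 := by
  simp [e, PowerSeries.rescale_zero, e0, exists_e0.choose_spec.2]

lemma pr_tM (M : ℕ) (a : R) : pr M (t ^ M * a) = 0 := by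
  rw [pr, Ideal.Quotient.eq_zero_iff_mem, Ideal.mem_span_singleton, t, ← pow_mul]
  exact Dvd.dvd.mul_right (pow_dvd_pow _ (by omega)) _

lemma mul_congr_of {S : Type*} [CommRing S] (φ : R →+* S) (x y z : R) (h : φ y = φ z) :
    φ (x * y) = φ (x * z) := by
  rw [map_mul, map_mul, h]

lemma F_lim (a b c β : R) (h : b * c = t * β) (M : ℕ) :
    pr M (F a b c (a * β)) = pr M ((∏ i ∈ Finset.range M, (1 + t ^ i * a)) * F 0 b c 0) := by
  have h1 : pr M (F (t ^ M * a) b c (t ^ M * a * β)) = pr M (F 0 b c 0) :=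
    L_congr M _ _ (map_W (pr M) _ b c β (pr_tM M a))
  have h2 := mul_congr_of (pr M) (∏ i ∈ Finset.range M, (1 + t ^ i * a)) _ _ h1
  exact (congrArg (pr M) (F_iter a b c β h M)).trans h2

lemma key (a b c β : R) (h : b * c = t * β) (M : ℕ) :
    pr M (F a b c (a * β)) = pr M (∏ i ∈ Finset.range M,
      ((1 + t ^ i * a) * (1 + t ^ i * b) * (1 + t ^ i * c))) := by
  have s1 : F 0 b c 0 = F b 0 c (b * 0) := by
    simp only [F, W, zero_mul, mul_zero]
    rw [mul_comm (E 0) (E b), mul_right_comm (E b * E 0 * E c)]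
    rw [mul_right_comm (E b * E 0 * E c * e 0)]
  have s2 : F 0 0 c 0 = F c 0 0 (c * 0) := by
    simp only [F, W, zero_mul, mul_zero]
    rw [mul_comm (E 0 * E 0) (E c), ← mul_assoc (E c) (E 0) (E 0)]
  have s3 : F 0 0 0 0 = 1 := by
    simp [F, W, E_zero, e_zero, L_one]
  have h1 := F_lim a b c β h M
  have h2 := F_lim b 0 c 0 (by rw [zero_mul, mul_zero]) M
  have h3 := F_lim c 0 0 0 (by rw [zero_mul, mul_zero]) M
  rw [← s1] at h2
  rw [← s2, s3] at h3
  refine h1.trans ((mul_congr_of (pr M) _ _ _ (h2.trans (mul_congr_of (pr M) _ _ _ h3))).trans ?_)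
  refine congrArg (pr M) ?_
  rw [Finset.prod_mul_distrib, Finset.prod_mul_distrib, mul_one, mul_assoc]

/-- The least `m ≥ i` with `m ≡ r (mod 6)`. -/
def nx (r i : ℕ) : ℕ := i + (r + 5 * i) % 6

/-- The product over `m ≥ i`. -/
noncomputable def Phi (i : ℕ) : RX :=
  E (q ^ nx 2 i) * E (q ^ nx 4 i) * E (q ^ nx 5 i) *
    e (q ^ nx 0 i) * e (q ^ nx 1 i) * e (q ^ nx 3 i)

lemma nx_six (r i : ℕ) : q ^ nx r (i + 6) = t * q ^ nx r i := by
  rw [t, ← pow_add]; congr 1; unfold nx; omega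

lemma nx_self (r i : ℕ) (_ : r < 6) (h : i % 6 = r) : nx r i = i := by unfold nx; omega
lemma nx_succ_self (r i : ℕ) (_ : r < 6) (h : i % 6 = r) :
    q ^ nx r (i + 1) = t * q ^ i := by
  rw [t, ← pow_add]; congr 1; unfold nx; omega
lemma nx_succ_ne (r i : ℕ) (_ : r < 6) (h : i % 6 ≠ r) : nx r (i + 1) = nx r i := by
  unfold nx; omega

lemma Phi_six (i : ℕ) : Phi (i + 6) = rescale t (Phi i) := by
  simp only [Phi, nx_six, map_mul, rescale_E, rescale_e]

/-- strict residues -/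
def Str (i : ℕ) : Prop := i % 6 = 0 ∨ i % 6 = 1 ∨ i % 6 = 3

instance (i : ℕ) : Decidable (Str i) := by unfold Str; infer_instance

/-- next allowed -/
def nxt (i : ℕ) : ℕ := if Str i then i + 7 else i + 6

lemma Phi_strict (i : ℕ) (h : Str i) : Phi i = Phi (i + 1) + C (q ^ i) * (X * Phi (i + 1)) := by
  have : i % 6 = 0 ∨ i % 6 = 1 ∨ i % 6 = 3 := h
  rcases this with h | h | h
  · unfold Phi
    rw [nx_self 0 i (by norm_num) h, nx_succ_self 0 i (by norm_num) h, e_t (q ^ i)]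
    rw [nx_succ_ne 1, nx_succ_ne 2, nx_succ_ne 3, nx_succ_ne 4, nx_succ_ne 5] <;> try omega
    ring
  · unfold Phi
    rw [nx_self 1 i (by norm_num) h, nx_succ_self 1 i (by norm_num) h, e_t (q ^ i)]
    rw [nx_succ_ne 0, nx_succ_ne 2, nx_succ_ne 3, nx_succ_ne 4, nx_succ_ne 5] <;> try omega
    ring
  · unfold Phi
    rw [nx_self 3 i (by norm_num) h, nx_succ_self 3 i (by norm_num) h, e_t (q ^ i)]
    rw [nx_succ_ne 1, nx_succ_ne 2, nx_succ_ne 0, nx_succ_ne 4, nx_succ_ne 5] <;> try omega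
    ring

lemma Phi_weak (i : ℕ) (h : ¬ Str i) : Phi i = Phi (i + 1) + C (q ^ i) * (X * Phi i) := by
  have : i % 6 = 2 ∨ i % 6 = 4 ∨ i % 6 = 5 := by unfold Str at h; omega
  rcases this with h | h | h
  · unfold Phi
    rw [nx_self 2 i (by norm_num) h, nx_succ_self 2 i (by norm_num) h, E_t (q ^ i)]
    rw [nx_succ_ne 1, nx_succ_ne 0, nx_succ_ne 3, nx_succ_ne 4, nx_succ_ne 5] <;> try omega
    ring
  · unfold Phi
    rw [nx_self 4 i (by norm_num) h, nx_succ_self 4 i (by norm_num) h, E_t (q ^ i)]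
    rw [nx_succ_ne 0, nx_succ_ne 2, nx_succ_ne 3, nx_succ_ne 1, nx_succ_ne 5] <;> try omega
    ring
  · unfold Phi
    rw [nx_self 5 i (by norm_num) h, nx_succ_self 5 i (by norm_num) h, E_t (q ^ i)]
    rw [nx_succ_ne 1, nx_succ_ne 2, nx_succ_ne 0, nx_succ_ne 4, nx_succ_ne 3] <;> try omega
    ring

lemma LPhi_step (i : ℕ) : L (Phi i) = L (Phi (i + 1)) + q ^ i * L (Phi (nxt i)) := by
  by_cases h : Str i
  · rw [nxt, if_pos h, show i + 7 = (i + 1) + 6 by ring, Phi_six, ← L_X_mul, ← L_C_mul, ← L_add,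
      ← Phi_strict i h]
  · rw [nxt, if_neg h, Phi_six, ← L_X_mul, ← L_C_mul, ← L_add, ← Phi_weak i h]

lemma pr_q (M m : ℕ) (h : M ≤ m) : pr M (q ^ m) = pr M 0 := by
  rw [map_zero, pr, Ideal.Quotient.eq_zero_iff_mem, Ideal.mem_span_singleton]
  exact pow_dvd_pow _ h

lemma map_Phi {S : Type*} [CommRing S] (φ : R →+* S) (i : ℕ) (hx : ∀ r, φ (q ^ nx r i) = φ 0) :
    PowerSeries.map φ (Phi i) = PowerSeries.map φ 1 := by
  simp only [Phi, map_mul]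
  rw [map_E φ _ _ (hx 2), map_E φ _ _ (hx 4), map_E φ _ _ (hx 5), map_e φ _ _ (hx 0),
    map_e φ _ _ (hx 1), map_e φ _ _ (hx 3)]
  simp [E_zero, e_zero]

lemma LPhi_base (i N : ℕ) (h : N < i) : coeff N (L (Phi i)) = if N = 0 then 1 else 0 := by
  have : pr i (L (Phi i)) = pr i (L 1) :=
    L_congr i _ _ (map_Phi (pr i) i fun r => pr_q _ _ (by unfold nx; omega))
  rw [(pr_eq_iff i _ _).1 this N h, L_one, coeff_one]

/-- ascending chain relation -/
def Asc (y x : ℕ) : Prop := y + 6 ≤ x ∧ (Str x → y + 6 < x)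

/-- Ascending lists with sum `N` and parts at least `i`. -/
def S (N i : ℕ) : Set (List ℕ) := {l | l.sum = N ∧ (∀ x ∈ l, i ≤ x) ∧ l.IsChain Asc}

lemma S_base (N i : ℕ) (h : N < i) : S N i = if N = 0 then {[]} else ∅ := by
  ext l
  constructor
  · rintro ⟨h1, h2, -⟩
    cases l with
    | nil => simp at h1; simp [← h1]
    | cons x l =>
      have := h2 x (by simp)
      simp at h1; omega
  · split_ifs with h0
    · rintro rfl; simp [S, h0]
    · simp

lemma Asc_iff (y x : ℕ) : Asc y x ↔ nxt y ≤ x := by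
  unfold Asc nxt
  split_ifs with h <;> unfold Str at * <;> omega

lemma lt_nxt (y : ℕ) : y < nxt y := by unfold nxt; split_ifs <;> omega

lemma chain_ge (i : ℕ) (l : List ℕ) (h : (i :: l).IsChain Asc) : ∀ x ∈ l, nxt i ≤ x := by
  induction l generalizing i with
  | nil => simp
  | cons y l ih =>
    rw [List.isChain_cons_cons, Asc_iff] at h
    intro x hx
    rcases List.mem_cons.1 hx with rfl | hx
    · exact h.1
    · have := ih y h.2 x hx
      have := lt_nxt y
      omega

lemma cons_chain (i : ℕ) (l : List ℕ) :
    (i :: l).IsChain Asc ↔ (∀ x ∈ l, nxt i ≤ x) ∧ l.IsChain Asc := by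
  constructor
  · intro h; exact ⟨chain_ge i l h, h.tail⟩
  · rintro ⟨h1, h2⟩
    cases l with
    | nil => simp
    | cons y l =>
      rw [List.isChain_cons_cons, Asc_iff]
      exact ⟨h1 y (by simp), h2⟩

lemma S_step (N i : ℕ) (h : i ≤ N) :
    S N i = S N (i + 1) ∪ Set.image (List.cons i) (S (N - i) (nxt i)) := by
  ext l
  constructor
  · rintro ⟨h1, h2, h3⟩
    cases l with
    | nil => left; exact ⟨h1, by simp, by simp⟩
    | cons x l =>
      have hx := h2 x (by simp)
      have h4 := (cons_chain x l).1 h3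
      by_cases hxi : x = i
      · subst hxi
        right
        refine ⟨l, ⟨?_, h4.1, h4.2⟩, rfl⟩
        simp at h1; omega
      · left
        refine ⟨h1, fun y hy => ?_, h3⟩
        rcases List.mem_cons.1 hy with rfl | hy
        · omega
        · have := h4.1 y hy
          have := lt_nxt x
          omega
  · rintro (⟨h1, h2, h3⟩ | ⟨l, ⟨h1, h2, h3⟩, rfl⟩)
    · exact ⟨h1, fun x hx => by have := h2 x hx; omega, h3⟩
    · refine ⟨by simp; omega, fun y hy => ?_, (cons_chain i l).2 ⟨h2, h3⟩⟩
      rcases List.mem_cons.1 hy with rfl | hy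
      · exact le_rfl
      · have := h2 y hy
        have := lt_nxt i
        omega

lemma S_disj (N N' i j : ℕ) : Disjoint (S N (i + 1)) (Set.image (List.cons i) (S N' j)) := by
  rw [Set.disjoint_left]
  rintro l ⟨-, h2, -⟩ ⟨l', -, rfl⟩
  have := h2 i (by simp)
  omega

lemma S_card (N i : ℕ) : ∃ k : ℕ, (S N i).encard = k ∧ coeff N (L (Phi i)) = (k : ℚ) ∨
    i = 0 := by
  induction hm : N + 1 - i using Nat.strong_induction_on generalizing N i with
  | _ m ih =>
    by_cases hi : i = 0
    · exact ⟨0, Or.inr hi⟩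
    by_cases hN : N < i
    · rw [S_base N i hN, LPhi_base i N hN]
      split_ifs
      · exact ⟨1, Or.inl (by simp)⟩
      · exact ⟨0, Or.inl (by simp)⟩
    · push Not at hN
      have hl := lt_nxt i
      obtain ⟨k1, hk1 | hk1⟩ := ih _ (by omega) N (i + 1) rfl
      swap
      · omega
      obtain ⟨k2, hk2 | hk2⟩ := ih _ (by omega) (N - i) (nxt i) rfl
      swap
      · omega
      refine ⟨k1 + k2, Or.inl ⟨?_, ?_⟩⟩
      · rw [S_step N i hN, Set.encard_union_eq (S_disj _ _ _ _),
          (List.cons_injective).encard_image, hk1.1, hk2.1]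
        simp
      · rw [LPhi_step, map_add, hk1.2, q, PowerSeries.coeff_X_pow_mul', if_pos hN, hk2.2]
        simp

/-- Ascending Göllnitz lists. -/
def G (N : ℕ) : Set (List ℕ) :=
  {l | l.sum = N ∧ (∀ x ∈ l, 0 < x ∧ x ≠ 1 ∧ x ≠ 3) ∧ l.IsChain Asc}

lemma G_eq (N : ℕ) : G N = S N 4 ∪ (if 2 ≤ N then Set.image (List.cons 2) (S (N - 2) 8) else ∅) := by
  have hn : nxt 2 = 8 := by decide
  ext l
  constructor
  · rintro ⟨h1, h2, h3⟩
    cases l with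
    | nil => left; exact ⟨h1, by simp, by simp⟩
    | cons x l =>
      have hx := h2 x (by simp)
      have h4 := (cons_chain x l).1 h3
      by_cases hxi : x = 2
      · subst hxi
        right
        simp at h1
        rw [if_pos (by omega)]
        refine ⟨l, ⟨by omega, hn ▸ h4.1, h4.2⟩, rfl⟩
      · left
        refine ⟨h1, fun y hy => ?_, h3⟩
        rcases List.mem_cons.1 hy with rfl | hy
        · omega
        · have := h4.1 y hy
          have := lt_nxt x
          omega
  · rintro (⟨h1, h2, h3⟩ | h)
    · exact ⟨h1, fun x hx => by have := h2 x hx; omega, h3⟩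
    · split_ifs at h with h0
      · obtain ⟨l, ⟨h1, h2, h3⟩, rfl⟩ := h
        refine ⟨by simp; omega, fun y hy => ?_, (cons_chain 2 l).2 ⟨hn ▸ h2, h3⟩⟩
        rcases List.mem_cons.1 hy with rfl | hy
        · omega
        · have := h2 y hy
          omega
      · exact h.elim

lemma LPsi : L (Phi 4) + q ^ 2 * L (Phi 8) = F (q ^ 2) (q ^ 4) (q ^ 5) (q ^ 2 * q ^ 3) := by
  rw [show 8 = 2 + 6 by norm_num, Phi_six, ← L_X_mul, ← L_C_mul, ← L_add, F]
  congr 1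
  have h2 : Phi 2 = E (q ^ 2) * E (q ^ 4) * E (q ^ 5) * e (q ^ 6) * e (q ^ 7) * e (q ^ 3) := rfl
  have h4 : Phi 4 = E (q ^ 8) * E (q ^ 4) * E (q ^ 5) * e (q ^ 6) * e (q ^ 7) * e (q ^ 9) := rfl
  rw [h2, h4, W, e_t (q ^ 3), show q ^ 8 = t * q ^ 2 by rw [t]; ring, E_t, t]
  simp only [← pow_add]
  norm_num only
  simp only [map_pow]
  ring

lemma G_card (N : ℕ) : ∃ k : ℕ, (G N).encard = k ∧
    coeff N (F (q ^ 2) (q ^ 4) (q ^ 5) (q ^ 2 * q ^ 3)) = (k : ℚ) := by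
  obtain ⟨k1, hk1 | hk1⟩ := S_card N 4
  swap
  · omega
  obtain ⟨k2, hk2 | hk2⟩ := S_card (N - 2) 8
  swap
  · omega
  rw [← LPsi, G_eq, map_add, q, PowerSeries.coeff_X_pow_mul']
  split_ifs with h
  · refine ⟨k1 + k2, ?_, ?_⟩
    · rw [Set.encard_union_eq, (List.cons_injective).encard_image, hk1.1, hk2.1]
      · simp
      · rw [Set.disjoint_left]
        rintro l ⟨-, h2, -⟩ ⟨l', -, rfl⟩
        have := h2 2 (by simp)
        omega
    · rw [hk1.2, hk2.2]; simp
  · exact ⟨k1, by rw [Set.union_empty, hk1.1], by rw [hk1.2, add_zero]⟩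

/-- good residues -/
def Good (x : ℕ) : Prop := x % 6 = 2 ∨ x % 6 = 4 ∨ x % 6 = 5

instance (i : ℕ) : Decidable (Good i) := by unfold Good; infer_instance

/-- distinct lists with parts less than `m` -/
def D (N m : ℕ) : Set (List ℕ) :=
  {l | l.sum = N ∧ (∀ x ∈ l, Good x) ∧ l.IsChain (· > ·) ∧ ∀ x ∈ l, x < m}

/-- finite product -/
noncomputable def P (m : ℕ) : R := ∏ k ∈ Finset.range m, if Good k then 1 + q ^ k else 1

lemma gt_chain (x : ℕ) (l : List ℕ) :
    (x :: l).IsChain (· > ·) ↔ (∀ y ∈ l, y < x) ∧ l.IsChain (· > ·) := by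
  rw [List.isChain_iff_pairwise, List.isChain_iff_pairwise, List.pairwise_cons]

lemma D_step (N m : ℕ) : D N (m + 1) =
    D N m ∪ (if Good m ∧ m ≤ N then Set.image (List.cons m) (D (N - m) m) else ∅) := by
  ext l
  constructor
  · rintro ⟨h1, h2, h3, h4⟩
    cases l with
    | nil => left; exact ⟨h1, by simp, by simp, by simp⟩
    | cons x l =>
      have hx := h4 x (by simp)
      have hg := h2 x (by simp)
      have h5 := (gt_chain x l).1 h3
      by_cases hxi : x = m
      · subst hxi
        right
        simp at h1
        rw [if_pos ⟨hg, by omega⟩]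
        exact ⟨l, ⟨by omega, fun y hy => h2 y (by simp [hy]), h5.2, h5.1⟩, rfl⟩
      · left
        refine ⟨h1, h2, h3, fun y hy => ?_⟩
        rcases List.mem_cons.1 hy with rfl | hy
        · omega
        · have := h5.1 y hy
          omega
  · rintro (⟨h1, h2, h3, h4⟩ | h)
    · exact ⟨h1, h2, h3, fun x hx => by have := h4 x hx; omega⟩
    · split_ifs at h with h0
      · obtain ⟨l, ⟨h1, h2, h3, h4⟩, rfl⟩ := h
        refine ⟨by simp; omega, fun y hy => ?_, (gt_chain m l).2 ⟨h4, h3⟩, fun y hy => ?_⟩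
        · rcases List.mem_cons.1 hy with rfl | hy
          · exact h0.1
          · exact h2 y hy
        · rcases List.mem_cons.1 hy with rfl | hy
          · omega
          · have := h4 y hy
            omega
      · exact h.elim

lemma D_card (N m : ℕ) : ∃ k : ℕ, (D N m).encard = k ∧ coeff N (P m) = (k : ℚ) := by
  induction m generalizing N with
  | zero =>
    have : D N 0 = if N = 0 then {[]} else ∅ := by
      ext l
      cases l with
      | nil => split_ifs with h <;> simp [D, h, eq_comm]
      | cons x l =>
        have : (x :: l) ∉ D N 0 := fun h => absurd (h.2.2.2 x (by simp)) (by omega)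
        split_ifs <;> simp [this]
    rw [this, P]
    split_ifs with h
    · exact ⟨1, by simp, by simp [h]⟩
    · exact ⟨0, by simp, by simp [coeff_one, h]⟩
  | succ m ih =>
    obtain ⟨k1, hk1⟩ := ih N
    obtain ⟨k2, hk2⟩ := ih (N - m)
    have hP : P (m + 1) = P m * if Good m then 1 + q ^ m else 1 := by
      rw [P, Finset.prod_range_succ, P]
    rw [D_step, hP]
    by_cases hg : Good m
    · rw [if_pos hg, mul_add, mul_one, map_add, q, PowerSeries.coeff_mul_X_pow']
      by_cases hN : m ≤ N
      · rw [if_pos ⟨hg, hN⟩, if_pos hN]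
        refine ⟨k1 + k2, ?_, by rw [hk1.2, hk2.2]; simp⟩
        rw [Set.encard_union_eq, (List.cons_injective).encard_image, hk1.1, hk2.1]
        · simp
        · rw [Set.disjoint_left]
          rintro l ⟨-, -, -, h2⟩ ⟨l', -, rfl⟩
          have := h2 m (by simp)
          omega
      · rw [if_neg (fun h => hN h.2), if_neg hN]
        exact ⟨k1, by rw [Set.union_empty, hk1.1], by rw [hk1.2, add_zero]⟩
    · rw [if_neg hg, if_neg (fun h => hg h.1)]
      exact ⟨k1, by rw [Set.union_empty, hk1.1], by rw [mul_one, hk1.2]⟩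

lemma P_six (M : ℕ) : P (6 * M) = ∏ i ∈ Finset.range M,
      ((1 + t ^ i * q ^ 2) * (1 + t ^ i * q ^ 4) * (1 + t ^ i * q ^ 5)) := by
  induction M with
  | zero => simp [P]
  | succ M ih =>
    rw [Finset.prod_range_succ, ← ih, show 6 * (M + 1) = 6 * M + 1 + 1 + 1 + 1 + 1 + 1 by ring, P]
    simp only [Finset.prod_range_succ]
    rw [if_neg (by unfold Good; omega), if_neg (by unfold Good; omega),
      if_pos (by unfold Good; omega), if_neg (by unfold Good; omega),
      if_pos (by unfold Good; omega), if_pos (by unfold Good; omega), ← P, t]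
    ring

lemma D_all (N : ℕ) : D N (6 * (N + 1)) =
    {l | l.sum = N ∧ (∀ x ∈ l, Good x) ∧ l.IsChain (· > ·)} := by
  ext l
  constructor
  · rintro ⟨h1, h2, h3, -⟩; exact ⟨h1, h2, h3⟩
  · rintro ⟨h1, h2, h3⟩
    refine ⟨h1, h2, h3, fun x hx => ?_⟩
    have := List.single_le_sum (l := l) (by simp) x hx
    omega

lemma main (N : ℕ) : (G N).ncard = (D N (6 * (N + 1))).ncard := by
  obtain ⟨k1, h1, h1'⟩ := G_card N
  obtain ⟨k2, h2, h2'⟩ := D_card N (6 * (N + 1))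
  have hk := key (q ^ 2) (q ^ 4) (q ^ 5) (q ^ 3) (by rw [t]; ring) (N + 1)
  rw [← P_six] at hk
  have := (pr_eq_iff _ _ _).1 hk N (by omega)
  rw [h1', h2'] at this
  have : k1 = k2 := by exact_mod_cast this
  rw [Set.ncard, Set.ncard, h1, h2, this]

end Gollnitz

/-- Göllnitz's partition theorem.  Partitions are represented as weakly
decreasing lists of positive integers (here the ordering conditions are forced
by the chain conditions).  The left-hand side counts partitions of `N` with no
part equal to `1` or `3` and with the difference of consecutive parts at least
`6`, strictly greater than `6` whenever the larger part is `≡ 0, 1, 3 (mod 6)`.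
The right-hand side counts partitions of `N` into distinct parts that are
`≡ 2, 4, 5 (mod 6)` (recorded as strictly decreasing lists). -/
theorem gollnitz (N : ℕ) :
    Nat.card {l : List ℕ // l.sum = N ∧ (∀ x ∈ l, 0 < x ∧ x ≠ 1 ∧ x ≠ 3) ∧
        l.Chain' (fun x y =>
          y + 6 ≤ x ∧ ((x % 6 = 0 ∨ x % 6 = 1 ∨ x % 6 = 3) → y + 6 < x))} =
      Nat.card {l : List ℕ // l.sum = N ∧
        (∀ x ∈ l, x % 6 = 2 ∨ x % 6 = 4 ∨ x % 6 = 5) ∧ l.Chain' (· > ·)} := by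
  have hD := Gollnitz.D_all N
  have hm := Gollnitz.main N
  rw [hD] at hm
  have hG : Gollnitz.G N = Set.image List.reverse {l : List ℕ | l.sum = N ∧
      (∀ x ∈ l, 0 < x ∧ x ≠ 1 ∧ x ≠ 3) ∧ l.IsChain (fun x y =>
          y + 6 ≤ x ∧ ((x % 6 = 0 ∨ x % 6 = 1 ∨ x % 6 = 3) → y + 6 < x))} := by
    ext l
    constructor
    · rintro ⟨h1, h2, h3⟩
      refine ⟨l.reverse, ⟨by simpa using h1, by simpa using h2, ?_⟩, by simp⟩
      rw [List.isChain_reverse]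
      exact h3
    · rintro ⟨l, ⟨h1, h2, h3⟩, rfl⟩
      refine ⟨by simpa using h1, by simpa using h2, ?_⟩
      rw [List.isChain_reverse]
      exact h3
  rw [hG, Set.ncard_image_of_injective _ List.reverse_injective] at hm
  exact hm
end
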